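/- arXiv:2110.07042 — 8 statements merged into one kernel-verified Lean document; each statement's English description precedes it below -/
import Mathlib

section
/- Let G=(V,E) be a finite undirected graph, n ≥ 1, 2j ∈ ℕ, and let p = (p_0,…,p_n) be a probability vector with all p_i > 0. Then the product measure W(ξ) = Π_{x∈V} w_p(ξ^x) on Ω_{2j}^V is reversible for the multi-species SEP(2j); equivalently, its generator L is self-adjoint in l²(W): for all functions f,g: Ω_{2j}^V → ℝ one has Σ_ξ W(ξ) f(ξ)(Lg)(ξ) = Σ_ξ W(ξ) g(ξ)(Lf)(ξ). -/
/-- The state space `Ω_{2j}` of single-site configurations; `m` plays the role of `2j`. -/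
def Omega (n m : ℕ) : Finset (Fin (n + 1) → ℕ) :=
  Finset.Nat.antidiagonalTuple (n + 1) m

/-- `conf ξ k l = ξ + e_k − e_l` (with truncated subtraction on ℕ; the relevant
occupation-number prefactors vanish whenever the truncation matters). -/
def conf {d : ℕ} (ξ : Fin d → ℕ) (k l : Fin d) : Fin d → ℕ :=
  fun i => (if i = k then ξ i + 1 else ξ i) - (if i = l then 1 else 0)

/-- Multinomial weight `w_p(ξ) = (2j)!/(ξ_0!⋯ξ_n!) ∏ p_i^{ξ_i}`. -/
noncomputable def wp {d : ℕ} (m : ℕ) (p : Fin d → ℝ) (ξ : Fin d → ℕ) : ℝ :=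
  ((Nat.factorial m : ℝ) / ∏ i, (Nat.factorial (ξ i) : ℝ)) * ∏ i, p i ^ ξ i

/-- The configuration `ξ^{x,y}_{l,k}`: at site `x` replace `ξ^x` by `ξ^x − e_l + e_k`,
at site `y` replace `ξ^y` by `ξ^y − e_k + e_l`. -/
def sepMove {V : Type*} [DecidableEq V] {d : ℕ} (ζ : V → Fin d → ℕ) (x y : V)
    (k l : Fin d) : V → Fin d → ℕ :=
  fun v => if v = x then conf (ζ x) k l else if v = y then conf (ζ y) l k else ζ v

/-- Single-edge generator `L_{x,y}` of the multi-species SEP(2j). -/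
noncomputable def sepEdge {V : Type*} [DecidableEq V] (n : ℕ) (x y : V)
    (f : (V → Fin (n + 1) → ℕ) → ℝ) (ζ : V → Fin (n + 1) → ℕ) : ℝ :=
  ∑ k : Fin (n + 1), ∑ l : Fin (n + 1),
    if k < l then
      (ζ x l * ζ y k : ℝ) * (f (sepMove ζ x y k l) - f ζ) +
        (ζ y l * ζ x k : ℝ) * (f (sepMove ζ y x k l) - f ζ)
    else 0

/-- Generator of the multi-species SEP(2j) on a finite undirected graph whose edges are
listed (in an arbitrary orientation, which is irrelevant since `L_{x,y} = L_{y,x}`). -/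
noncomputable def sepGen {V : Type*} [DecidableEq V] (n : ℕ) (E : Finset (V × V))
    (f : (V → Fin (n + 1) → ℕ) → ℝ) (ζ : V → Fin (n + 1) → ℕ) : ℝ :=
  ∑ e ∈ E, sepEdge n e.1 e.2 f ζ

lemma conf_exists {d : ℕ} (ξ : Fin d → ℕ) (k l : Fin d) (hkl : k ≠ l) (h : 0 < ξ l) :
    ∃ η : Fin d → ℕ, ξ = η + Pi.single l 1 ∧ conf ξ k l = η + Pi.single k 1 := by
  refine ⟨fun i => ξ i - (if i = l then 1 else 0), ?_, ?_⟩
  · funext i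
    by_cases hi : i = l
    · subst hi; simp; omega
    · simp [hi]
  · funext i
    by_cases hi : i = l
    · subst hi; simp [conf, hkl.symm]
    · by_cases hk : i = k
      · subst hk; simp [conf, hi]
      · simp [conf, hi, hk]

lemma wp_add_single {d m : ℕ} (p : Fin d → ℝ) (η : Fin d → ℕ) (k : Fin d) :
    wp m p (η + Pi.single k 1) * ((η k : ℝ) + 1) = wp m p η * p k := by
  have h1 : ∀ ζ : Fin d → ℕ, wp m p ζ = (Nat.factorial m : ℝ) *
      ∏ i, (p i ^ ζ i / (Nat.factorial (ζ i) : ℝ)) := by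
    intro ζ
    rw [wp, Finset.prod_div_distrib]; ring
  rw [h1, h1, ← Finset.mul_prod_erase _ _ (Finset.mem_univ k),
    ← Finset.mul_prod_erase (Finset.univ) (fun i => p i ^ η i / (Nat.factorial (η i) : ℝ))
      (Finset.mem_univ k)]
  have h2 : ∏ i ∈ Finset.univ.erase k, (p i ^ (η + Pi.single k 1 : Fin d → ℕ) i /
        (Nat.factorial ((η + Pi.single k 1 : Fin d → ℕ) i) : ℝ)) =
      ∏ i ∈ Finset.univ.erase k, (p i ^ η i / (Nat.factorial (η i) : ℝ)) := by
    apply Finset.prod_congr rfl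
    intro i hi
    have : i ≠ k := Finset.ne_of_mem_erase hi
    simp [this]
  rw [h2]
  have h3 : (Nat.factorial (η k) : ℝ) ≠ 0 := by positivity
  have h4 : ((η k : ℝ) + 1) ≠ 0 := by positivity
  simp only [Pi.add_apply, Pi.single_eq_same, Nat.factorial_succ, pow_succ]
  push_cast
  field_simp

lemma wp_conf {d m : ℕ} (p : Fin d → ℝ) (ξ : Fin d → ℕ) (k l : Fin d) (hkl : k ≠ l)
    (h : 0 < ξ l) :
    wp m p (conf ξ k l) * (conf ξ k l k : ℝ) * p l = wp m p ξ * (ξ l : ℝ) * p k := by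
  obtain ⟨η, h1, h2⟩ := conf_exists ξ k l hkl h
  rw [h2, h1]
  have e1 := wp_add_single (m := m) p η k
  have e2 := wp_add_single (m := m) p η l
  simp only [Pi.add_apply, Pi.single_eq_same]
  push_cast
  rw [e1, e2]; ring

lemma conf_mem {n m : ℕ} (ξ : Fin (n + 1) → ℕ) (k l : Fin (n + 1)) (hkl : k ≠ l)
    (h : 0 < ξ l) (hξ : ξ ∈ Omega n m) : conf ξ k l ∈ Omega n m := by
  obtain ⟨η, h1, h2⟩ := conf_exists ξ k l hkl h
  rw [Omega, Finset.Nat.mem_antidiagonalTuple] at *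
  rw [h2]; rw [h1] at hξ
  simpa [Finset.sum_add_distrib] using hξ

lemma conf_conf {d : ℕ} (ξ : Fin d → ℕ) (k l : Fin d) (hkl : k ≠ l) (h : 0 < ξ l) :
    conf (conf ξ k l) l k = ξ := by
  funext i
  simp only [conf]
  by_cases hi : i = l
  · subst hi; simp [hkl.symm]; omega
  · by_cases hk : i = k
    · subst hk; simp [hi]
    · simp [hi, hk]

lemma conf_pos {d : ℕ} (ξ : Fin d → ℕ) (k l : Fin d) (hkl : k ≠ l) : 0 < conf ξ k l k := by
  simp [conf, hkl]

lemma move_left {V : Type*} [DecidableEq V] {d : ℕ} (ζ : V → Fin d → ℕ) (x y : V)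
    (k l : Fin d) : sepMove ζ x y k l x = conf (ζ x) k l := by simp [sepMove]

lemma move_right {V : Type*} [DecidableEq V] {d : ℕ} (ζ : V → Fin d → ℕ) (x y : V)
    (hxy : x ≠ y) (k l : Fin d) : sepMove ζ x y k l y = conf (ζ y) l k := by
  simp [sepMove, hxy.symm]

lemma move_other {V : Type*} [DecidableEq V] {d : ℕ} (ζ : V → Fin d → ℕ) (x y v : V)
    (hx : v ≠ x) (hy : v ≠ y) (k l : Fin d) : sepMove ζ x y k l v = ζ v := by
  simp [sepMove, hx, hy]

lemma move_move {V : Type*} [DecidableEq V] {d : ℕ} (ζ : V → Fin d → ℕ) (x y : V)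
    (hxy : x ≠ y) (k l : Fin d) (hkl : k ≠ l) (h1 : 0 < ζ x l) (h2 : 0 < ζ y k) :
    sepMove (sepMove ζ x y k l) y x k l = ζ := by
  funext v
  by_cases hx : v = x
  · subst hx
    rw [move_right _ _ _ hxy.symm, move_left, conf_conf _ _ _ hkl h1]
  · by_cases hy : v = y
    · subst hy
      rw [move_left, move_right _ _ _ hxy, conf_conf _ _ _ hkl.symm h2]
    · rw [move_other _ _ _ _ hy hx, move_other _ _ _ _ hx hy]

lemma detailed_balance {V : Type*} [Fintype V] [DecidableEq V] {d m : ℕ}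
    (p : Fin d → ℝ) (hp : ∀ i, 0 < p i) (ζ : V → Fin d → ℕ) (x y : V)
    (hxy : x ≠ y) (k l : Fin d) (hkl : k ≠ l) (h1 : 0 < ζ x l) (h2 : 0 < ζ y k) :
    (∏ v, wp m p (ζ v)) * ((ζ x l : ℝ) * ζ y k) =
      (∏ v, wp m p (sepMove ζ x y k l v)) *
        ((sepMove ζ x y k l y l : ℝ) * sepMove ζ x y k l x k) := by
  have split : ∀ F : V → ℝ, ∏ v, F v = F x * (F y * ∏ v ∈ (Finset.univ.erase x).erase y, F v) := by
    intro F
    rw [Finset.mul_prod_erase _ _ (by simp [hxy.symm]), Finset.mul_prod_erase _ _ (by simp)]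
  rw [split, split (fun v => wp m p (sepMove ζ x y k l v))]
  have h3 : ∏ v ∈ (Finset.univ.erase x).erase y, wp m p (sepMove ζ x y k l v) =
      ∏ v ∈ (Finset.univ.erase x).erase y, wp m p (ζ v) := by
    apply Finset.prod_congr rfl
    intro v hv
    simp only [Finset.mem_erase, Finset.mem_univ, and_true] at hv
    rw [move_other _ _ _ _ hv.2 hv.1]
  rw [h3, move_left, move_right _ _ _ hxy]
  have e1 := wp_conf (m := m) p (ζ x) k l hkl h1
  have e2 := wp_conf (m := m) p (ζ y) l k hkl.symm h2
  have hk := (hp k).ne'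
  have hl := (hp l).ne'
  apply mul_right_cancel₀ (mul_ne_zero hk hl)
  generalize ∏ v ∈ (Finset.univ.erase x).erase y, wp m p (ζ v) = R
  linear_combination (-R) * (wp m p (ζ y) * ζ y k * p l) * e1 -
    R * (wp m p (conf (ζ x) k l) * (conf (ζ x) k l k : ℝ) * p l) * e2

lemma exchange {V : Type*} [Fintype V] [DecidableEq V] (n m : ℕ)
    (p : Fin (n + 1) → ℝ) (hp : ∀ i, 0 < p i) (x y : V)
    (hxy : x ≠ y) (k l : Fin (n + 1)) (hkl : k ≠ l)
    (f g : (V → Fin (n + 1) → ℕ) → ℝ) :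
    ∑ ξ ∈ Fintype.piFinset (fun _ : V => Omega n m),
        (∏ v, wp m p (ξ v)) * ((ξ x l : ℝ) * ξ y k) * f ξ * g (sepMove ξ x y k l) =
      ∑ ξ ∈ Fintype.piFinset (fun _ : V => Omega n m),
        (∏ v, wp m p (ξ v)) * ((ξ y l : ℝ) * ξ x k) * g ξ * f (sepMove ξ y x k l) := by
  have red : ∀ (x y : V) (f g : (V → Fin (n + 1) → ℕ) → ℝ),
      ∑ ξ ∈ Fintype.piFinset (fun _ : V => Omega n m),
        (∏ v, wp m p (ξ v)) * ((ξ x l : ℝ) * ξ y k) * f ξ * g (sepMove ξ x y k l) =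
      ∑ ξ ∈ (Fintype.piFinset (fun _ : V => Omega n m)).filter
          (fun ξ => 0 < ξ x l ∧ 0 < ξ y k),
        (∏ v, wp m p (ξ v)) * ((ξ x l : ℝ) * ξ y k) * f ξ * g (sepMove ξ x y k l) := by
    intro x y f g
    symm
    apply Finset.sum_filter_of_ne
    intro ξ _ h
    constructor
    · apply Nat.pos_of_ne_zero
      intro h0; apply h; simp [h0]
    · apply Nat.pos_of_ne_zero
      intro h0; apply h; simp [h0]
  have maps : ∀ x y : V, x ≠ y → ∀ ξ ∈ (Fintype.piFinset (fun _ : V => Omega n m)).filter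
          (fun ξ => 0 < ξ x l ∧ 0 < ξ y k), sepMove ξ x y k l ∈
        (Fintype.piFinset (fun _ : V => Omega n m)).filter
          (fun ξ => 0 < ξ y l ∧ 0 < ξ x k) := by
    intro x y hxy ξ hξ
    simp only [Finset.mem_filter, Fintype.mem_piFinset] at hξ ⊢
    obtain ⟨h0, h1, h2⟩ := hξ
    refine ⟨fun v => ?_, ?_, ?_⟩
    · by_cases hx : v = x
      · subst hx
        rw [move_left]; exact conf_mem _ _ _ hkl h1 (h0 _)
      · by_cases hy : v = y
        · subst hy
          rw [move_right _ _ _ hxy]; exact conf_mem _ _ _ hkl.symm h2 (h0 _)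
        · rw [move_other _ _ _ _ hx hy]; exact h0 _
    · rw [move_right _ _ _ hxy]; exact conf_pos _ _ _ hkl.symm
    · rw [move_left]; exact conf_pos _ _ _ hkl
  rw [red x y f g, red y x g f]
  refine Finset.sum_nbij' (fun ξ => sepMove ξ x y k l) (fun ξ => sepMove ξ y x k l)
    (maps x y hxy) (maps y x hxy.symm) ?_ ?_ ?_
  · intro ξ hξ
    obtain ⟨_, h1, h2⟩ := Finset.mem_filter.1 hξ
    exact move_move _ _ _ hxy _ _ hkl h1 h2
  · intro ξ hξ
    obtain ⟨_, h1, h2⟩ := Finset.mem_filter.1 hξ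
    exact move_move _ _ _ hxy.symm _ _ hkl h1 h2
  · intro ξ hξ
    obtain ⟨_, h1, h2⟩ := Finset.mem_filter.1 hξ
    rw [move_move _ _ _ hxy _ _ hkl h1 h2, detailed_balance p hp ξ x y hxy k l hkl h1 h2]
    ring

/-- The product multinomial measure is reversible for the multi-species SEP(2j):
the generator is self-adjoint in `l²(W)`. -/
theorem sep_product_measure_reversible {V : Type*} [Fintype V] [DecidableEq V]
    (n m : ℕ) (hn : 1 ≤ n) (hm : 0 < m)
    (E : Finset (V × V)) (hE : ∀ e ∈ E, e.1 ≠ e.2)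
    (p : Fin (n + 1) → ℝ) (hp : ∀ i, 0 < p i) (hp1 : ∑ i, p i = 1)
    (f g : (V → Fin (n + 1) → ℕ) → ℝ) :
    ∑ ξ ∈ Fintype.piFinset (fun _ : V => Omega n m),
        (∏ x, wp m p (ξ x)) * f ξ * sepGen n E g ξ =
      ∑ ξ ∈ Fintype.piFinset (fun _ : V => Omega n m),
        (∏ x, wp m p (ξ x)) * g ξ * sepGen n E f ξ := by
  simp only [sepGen, sepEdge, Finset.mul_sum]
  rw [Finset.sum_comm, Finset.sum_comm (s := Fintype.piFinset (fun _ : V => Omega n m))]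
  refine Finset.sum_congr rfl fun e he => ?_
  rw [Finset.sum_comm, Finset.sum_comm (s := Fintype.piFinset (fun _ : V => Omega n m))]
  refine Finset.sum_congr rfl fun k _ => ?_
  rw [Finset.sum_comm, Finset.sum_comm (s := Fintype.piFinset (fun _ : V => Omega n m))]
  refine Finset.sum_congr rfl fun l _ => ?_
  by_cases hkl : k < l
  · simp only [hkl, if_true]
    have h1 := exchange n m p hp e.1 e.2 (hE e he) k l hkl.ne f g
    have h2 := exchange n m p hp e.2 e.1 (hE e he).symm k l hkl.ne f g
    rw [← sub_eq_zero] at h1 h2 ⊢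
    rw [← Finset.sum_sub_distrib] at h1 h2 ⊢
    rw [← add_zero (0 : ℝ)]
    nth_rewrite 1 [← h1]
    rw [← h2, ← Finset.sum_add_distrib]
    refine Finset.sum_congr rfl fun ξ _ => ?_
    ring
  · simp [hkl]
end

section
/- Let p̂ = (p̂_0,…,p̂_n) be a vector of nonzero complex numbers. On the space V_{2j} of homogeneous complex polynomials of total degree 2j in the commuting variables z_0,…,z_n, define the symmetric bilinear form determined by ⟨z^ξ, z^η⟩ = δ_{ξ,η} · (ξ_0!⋯ξ_n!)/(p̂_0^{ξ_0}⋯p̂_n^{ξ_n}) for ξ,η ∈ Ω_{2j}. Then for all 0 ≤ k ≠ l ≤ n and all v_1, v_2 ∈ V_{2j}: ⟨z_k ∂_{z_l} v_1, v_2⟩ = (p̂_l/p̂_k) ⟨v_1, z_l ∂_{z_k} v_2⟩, and ⟨z_l ∂_{z_l} v_1, v_2⟩ = ⟨v_1, z_l ∂_{z_l} v_2⟩. -/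
/-- The symmetric bilinear form on `V_{2j}` determined by
`⟨z^ξ, z^η⟩ = δ_{ξ,η} ξ!/p̂^ξ` on the monomial basis, written via coefficients. -/
noncomputable def krawtchoukForm (n m : ℕ) (phat : Fin (n + 1) → ℂ)
    (v w : MvPolynomial (Fin (n + 1)) ℂ) : ℂ :=
  ∑ ξ ∈ Omega n m,
    MvPolynomial.coeff (Finsupp.equivFunOnFinite.symm ξ) v *
      MvPolynomial.coeff (Finsupp.equivFunOnFinite.symm ξ) w *
      ((∏ i, (Nat.factorial (ξ i) : ℂ)) / ∏ i, phat i ^ ξ i)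

theorem krawtchoukForm_symm (n m : ℕ) (phat : Fin (n + 1) → ℂ)
    (v w : MvPolynomial (Fin (n + 1)) ℂ) :
    krawtchoukForm n m phat v w = krawtchoukForm n m phat w v := by
  unfold krawtchoukForm
  refine Finset.sum_congr rfl fun ξ _ => ?_
  ring

/-- Multiplication by `z_k` is adjoint to `∂_{z_k} / p̂_k`. -/
theorem krawtchoukForm_X_mul (n m : ℕ) (phat : Fin (n + 1) → ℂ) (hphat : ∀ i, phat i ≠ 0)
    (k : Fin (n + 1)) (u w : MvPolynomial (Fin (n + 1)) ℂ) :
    krawtchoukForm n (m + 1) phat (MvPolynomial.X k * u) w =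
      (phat k)⁻¹ * krawtchoukForm n m phat u (MvPolynomial.pderiv k w) := by
  unfold krawtchoukForm
  rw [Finset.mul_sum]
  symm
  refine Finset.sum_of_injOn (fun ζ => ζ + Pi.single k 1) ?_ ?_ ?_ ?_
  · intro a _ b _ h
    exact add_right_cancel h
  · intro a ha
    simp only [Omega, Finset.mem_coe, Finset.Nat.mem_antidiagonalTuple] at ha ⊢
    simp [Finset.sum_add_distrib, ha]
  · intro ξ hξ hn
    rw [MvPolynomial.coeff_X_mul', if_neg, zero_mul, zero_mul]
    intro hk
    have hk' : ξ k ≠ 0 := by simpa using hk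
    apply hn
    have hle : Pi.single k 1 ≤ ξ := by
      intro i
      by_cases h : i = k
      · subst h
        simpa using Nat.one_le_iff_ne_zero.mpr hk'
      · simp [h]
    refine ⟨ξ - Pi.single k 1, ?_, tsub_add_cancel_of_le hle⟩
    have h1 : ∑ i, ((ξ - Pi.single k 1 + Pi.single k 1 : Fin (n + 1) → ℕ)) i = m + 1 := by
      rw [tsub_add_cancel_of_le hle]
      simpa [Omega, Finset.Nat.mem_antidiagonalTuple] using hξ
    simp only [Omega, Finset.mem_coe, Finset.Nat.mem_antidiagonalTuple]
    simp only [Pi.add_apply, Finset.sum_add_distrib, Finset.sum_pi_single', Finset.mem_univ,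
      if_true, Finset.sum_pi_single] at h1
    simpa using h1
  · intro ζ _
    have he : Finsupp.equivFunOnFinite.symm (ζ + Pi.single k 1) =
        Finsupp.equivFunOnFinite.symm ζ + Finsupp.single k 1 := by
      ext i
      simp [Finsupp.single_apply, Pi.single_apply, eq_comm]
    have hf : (∏ i, (Nat.factorial ((ζ + Pi.single k 1 : Fin (n + 1) → ℕ) i) : ℂ)) =
        (ζ k + 1) * ∏ i, (Nat.factorial (ζ i) : ℂ) := by
      have : ∀ i, (Nat.factorial ((ζ + Pi.single k 1 : Fin (n + 1) → ℕ) i) : ℂ) =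
          (if i = k then (ζ k + 1 : ℂ) else 1) * (Nat.factorial (ζ i) : ℂ) := by
        intro i
        by_cases h : i = k
        · subst h
          simp [Nat.factorial_succ]
        · simp [h]
      simp_rw [this, Finset.prod_mul_distrib]
      simp
    have hp : (∏ i, phat i ^ ((ζ + Pi.single k 1 : Fin (n + 1) → ℕ) i)) =
        phat k * ∏ i, phat i ^ ζ i := by
      simp_rw [Pi.add_apply, pow_add, Finset.prod_mul_distrib]
      rw [mul_comm]
      congr 1
      rw [Finset.prod_eq_single k] <;> simp +contextual
    have hz : (∏ i, phat i ^ ζ i) ≠ 0 :=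
      Finset.prod_ne_zero_iff.mpr fun i _ => pow_ne_zero _ (hphat i)
    have hk := hphat k
    rw [hf, hp, he, MvPolynomial.coeff_pderiv, mul_comm (MvPolynomial.X k) u,
      MvPolynomial.coeff_mul_X]
    simp only [Finsupp.equivFunOnFinite_symm_apply_apply]
    field_simp

/-- On `V_{2j}`, the bilinear form `⟨z^ξ,z^η⟩ = δ_{ξ,η} ξ!/p̂^ξ` satisfies
`⟨z_k ∂_{z_l} v₁, v₂⟩ = (p̂_l/p̂_k) ⟨v₁, z_l ∂_{z_k} v₂⟩` for `k ≠ l`, and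
`⟨z_l ∂_{z_l} v₁, v₂⟩ = ⟨v₁, z_l ∂_{z_l} v₂⟩`. -/
theorem krawtchoukForm_adjoint (n m : ℕ) (hn : 1 ≤ n) (hm : 0 < m)
    (phat : Fin (n + 1) → ℂ) (hphat : ∀ i, phat i ≠ 0)
    (v₁ v₂ : MvPolynomial (Fin (n + 1)) ℂ)
    (hv₁ : v₁.IsHomogeneous m) (hv₂ : v₂.IsHomogeneous m) :
    (∀ k l : Fin (n + 1), k ≠ l →
      krawtchoukForm n m phat (MvPolynomial.X k * MvPolynomial.pderiv l v₁) v₂ =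
        (phat l / phat k) *
          krawtchoukForm n m phat v₁ (MvPolynomial.X l * MvPolynomial.pderiv k v₂)) ∧
    (∀ l : Fin (n + 1),
      krawtchoukForm n m phat (MvPolynomial.X l * MvPolynomial.pderiv l v₁) v₂ =
        krawtchoukForm n m phat v₁ (MvPolynomial.X l * MvPolynomial.pderiv l v₂)) := by
  obtain ⟨m, rfl⟩ : ∃ m', m = m' + 1 := ⟨m - 1, by omega⟩
  have key : ∀ k l : Fin (n + 1),
      krawtchoukForm n (m + 1) phat (MvPolynomial.X k * MvPolynomial.pderiv l v₁) v₂ =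
        (phat l / phat k) *
          krawtchoukForm n (m + 1) phat v₁ (MvPolynomial.X l * MvPolynomial.pderiv k v₂) := by
    intro k l
    rw [krawtchoukForm_symm n (m + 1) phat v₁, krawtchoukForm_X_mul n m phat hphat,
      krawtchoukForm_X_mul n m phat hphat,
      krawtchoukForm_symm n m phat (MvPolynomial.pderiv k v₂)]
    have hk := hphat k
    have hl := hphat l
    field_simp
  refine ⟨fun k l _ => key k l, fun l => ?_⟩
  rw [key l l, div_self (hphat l), one_mul]
end

section
/- Let κ = (ν,P,P̂,U) ∈ K_n, let 2j ∈ ℕ, and let K(ξ,η) for ξ,η ∈ Ω_{2j} be the multivariate Krawtchouk polynomials associated with κ. Then for all η, ζ ∈ Ω_{2j}: (i) Σ_{ξ∈Ω_{2j}} K(ξ,η) K(ξ,ζ) w_{p̂}(ξ) = p_0^{2j} δ_{η,ζ} / w_p(η), and (ii) Σ_{ξ∈Ω_{2j}} K(η,ξ) K(ζ,ξ) w_p(ξ) = p_0^{2j} δ_{η,ζ} / w_{p̂}(η). -/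
/-- Complex multinomial weight `w_p(ξ) = (2j)!/(ξ_0!⋯ξ_n!) ∏ p_i^{ξ_i}`. -/
noncomputable def wpC {d : ℕ} (m : ℕ) (p : Fin d → ℂ) (ξ : Fin d → ℕ) : ℂ :=
  ((Nat.factorial m : ℂ) / ∏ i, (Nat.factorial (ξ i) : ℂ)) * ∏ i, p i ^ ξ i

open Finset in
theorem mem_Omega_iff {n m : ℕ} {ξ : Fin (n + 1) → ℕ} : ξ ∈ Omega n m ↔ ∑ i, ξ i = m := by
  simp [Omega, Finset.Nat.mem_antidiagonalTuple]

/-- multinomial coefficient -/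
noncomputable def mc {d : ℕ} (m : ℕ) (ξ : Fin d → ℕ) : ℂ :=
  (Nat.factorial m : ℂ) / ∏ i, (Nat.factorial (ξ i) : ℂ)

theorem mc_ne {d : ℕ} (m : ℕ) (ξ : Fin d → ℕ) : mc m ξ ≠ 0 := by
  unfold mc
  refine div_ne_zero (by exact_mod_cast Nat.factorial_ne_zero m) ?_
  exact Finset.prod_ne_zero_iff.2 fun i _ => by exact_mod_cast Nat.factorial_ne_zero (ξ i)

theorem multinom (n m : ℕ) (a : Fin (n + 1) → ℂ) :
    ∑ ξ ∈ Omega n m, mc m ξ * ∏ i, a i ^ ξ i = (∑ i, a i) ^ m := by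
  rw [Finset.sum_pow_eq_sum_piAntidiag]
  have : Omega n m = Finset.univ.piAntidiag m := by
    ext ξ; simp [mem_Omega_iff]
  rw [this]
  refine Finset.sum_congr rfl fun ξ hξ => ?_
  have h1 : ∑ i, ξ i = m := by simpa using hξ
  congr 1
  unfold mc
  have h2 := Nat.multinomial_spec Finset.univ ξ
  rw [h1] at h2
  rw [← h2]
  push_cast
  rw [mul_div_cancel_left₀]
  exact Finset.prod_ne_zero_iff.2 fun i _ => by exact_mod_cast Nat.factorial_ne_zero (ξ i)

theorem coeff_unique (n m : ℕ) (a b : (Fin (n + 1) → ℕ) → ℂ)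
    (h : ∀ z : Fin (n + 1) → ℂ, ∑ ξ ∈ Omega n m, a ξ * ∏ i, z i ^ ξ i =
      ∑ ξ ∈ Omega n m, b ξ * ∏ i, z i ^ ξ i) : ∀ ξ ∈ Omega n m, a ξ = b ξ := by
  intro ξ hξ
  let F : ((Fin (n + 1) → ℕ) → ℂ) → MvPolynomial (Fin (n + 1)) ℂ := fun a =>
    ∑ ξ ∈ Omega n m, MvPolynomial.monomial (Finsupp.equivFunOnFinite.symm ξ) (a ξ)
  have hF : F a = F b := by
    apply MvPolynomial.funext
    intro z
    simpa [F, MvPolynomial.eval_monomial, Finsupp.prod_fintype] using h z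
  have hc : ∀ a, MvPolynomial.coeff (Finsupp.equivFunOnFinite.symm ξ) (F a) = a ξ := by
    intro a
    simp only [F, MvPolynomial.coeff_sum, MvPolynomial.coeff_monomial,
      EmbeddingLike.apply_eq_iff_eq]
    simp [hξ]
  rw [← hc a, ← hc b, hF]

/-- homogeneous generating function -/
theorem homog (n m : ℕ) (U : Matrix (Fin (n + 1)) (Fin (n + 1)) ℂ)
    (hU0 : ∀ k, U k 0 = 1)
    (K : (Fin (n + 1) → ℕ) → (Fin (n + 1) → ℕ) → ℂ)
    (η : Fin (n + 1) → ℕ) (hη : η ∈ Omega n m)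
    (hK : ∀ z : Fin (n + 1) → ℂ,
      ∑ ξ ∈ Omega n m,
          ((Nat.factorial m : ℂ) / ∏ i, (Nat.factorial (ξ i) : ℂ)) * K ξ η *
            ∏ l ∈ Finset.univ.erase (0 : Fin (n + 1)), z l ^ ξ l =
        ∏ k : Fin (n + 1),
          (1 + ∑ l ∈ Finset.univ.erase (0 : Fin (n + 1)), U k l * z l) ^ η k)
    (z : Fin (n + 1) → ℂ) :
    ∑ ξ ∈ Omega n m, mc m ξ * K ξ η * ∏ l, z l ^ ξ l = ∏ k, (∑ l, U k l * z l) ^ η k := by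
  have hd : Dense {z : Fin (n + 1) → ℂ | z 0 ≠ 0} :=
    (dense_compl_singleton (0 : ℂ)).preimage (isOpenMap_eval (0 : Fin (n + 1)))
  refine congrFun (Continuous.ext_on (f := fun z : Fin (n + 1) → ℂ =>
    ∑ ξ ∈ Omega n m, mc m ξ * K ξ η * ∏ l, z l ^ ξ l)
    (g := fun z => ∏ k, (∑ l, U k l * z l) ^ η k) hd (by fun_prop) (by fun_prop) ?_) z
  intro z hz
  have hz : z 0 ≠ 0 := hz
  have h := hK (fun l => z l / z 0)
  have e1 : ∏ k, (∑ l, U k l * z l) ^ η k = z 0 ^ m * ∏ k : Fin (n + 1),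
          (1 + ∑ l ∈ Finset.univ.erase (0 : Fin (n + 1)), U k l * (z l / z 0)) ^ η k := by
    rw [← mem_Omega_iff.1 hη, ← Finset.prod_pow_eq_pow_sum, ← Finset.prod_mul_distrib]
    refine Finset.prod_congr rfl fun k _ => ?_
    rw [← mul_pow, ← Finset.add_sum_erase _ _ (Finset.mem_univ (0 : Fin (n + 1))), hU0, mul_add,
      Finset.mul_sum]
    congr 2
    · ring
    · refine Finset.sum_congr rfl fun l _ => ?_
      field_simp
  show _ = ∏ k, (∑ l, U k l * z l) ^ η k
  rw [e1, ← h, Finset.mul_sum]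
  refine Finset.sum_congr rfl fun ξ hξ => ?_
  have e2 : ∏ l, z l ^ ξ l = z 0 ^ m *
      ∏ l ∈ Finset.univ.erase (0 : Fin (n + 1)), (z l / z 0) ^ ξ l := by
    rw [← mem_Omega_iff.1 hξ, ← Finset.prod_pow_eq_pow_sum,
      ← Finset.mul_prod_erase _ _ (Finset.mem_univ (0 : Fin (n + 1))),
      ← Finset.mul_prod_erase _ (fun i => z 0 ^ ξ i) (Finset.mem_univ (0 : Fin (n + 1))), mul_assoc,
      ← Finset.prod_mul_distrib]
    congr 1
    refine Finset.prod_congr rfl fun l _ => ?_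
    rw [← mul_pow]
    field_simp
  rw [e2]
  unfold mc
  ring

theorem duality (n m : ℕ) (U : Matrix (Fin (n + 1)) (Fin (n + 1)) ℂ)
    (K : (Fin (n + 1) → ℕ) → (Fin (n + 1) → ℕ) → ℂ)
    (hK : ∀ η ∈ Omega n m, ∀ z : Fin (n + 1) → ℂ,
      ∑ ξ ∈ Omega n m, mc m ξ * K ξ η * ∏ l, z l ^ ξ l = ∏ k, (∑ l, U k l * z l) ^ η k) :
    ∀ ξ ∈ Omega n m, ∀ x : Fin (n + 1) → ℂ,
      ∑ η ∈ Omega n m, mc m η * K ξ η * ∏ l, x l ^ η l = ∏ k, (∑ l, U l k * x l) ^ ξ k := by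
  intro ξ hξ x
  have := coeff_unique n m
    (fun ξ => mc m ξ * ∑ η ∈ Omega n m, mc m η * K ξ η * ∏ l, x l ^ η l)
    (fun ξ => mc m ξ * ∏ k, (∑ l, U l k * x l) ^ ξ k) ?_ ξ hξ
  · exact mul_left_cancel₀ (mc_ne m ξ) this
  intro z
  trans (∑ k, x k * ∑ l, U k l * z l) ^ m
  · rw [← multinom]
    simp_rw [mul_pow, Finset.prod_mul_distrib]
    symm
    rw [Finset.sum_congr rfl fun η hη => by rw [← hK η hη z]]
    simp_rw [Finset.mul_sum, Finset.sum_mul]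
    rw [Finset.sum_comm]
    refine Finset.sum_congr rfl fun _ _ => Finset.sum_congr rfl fun _ _ => ?_
    ring
  · have : ∑ k, x k * ∑ l, U k l * z l = ∑ l, (∑ k, U k l * x k) * z l := by
      simp_rw [Finset.mul_sum, Finset.sum_mul]
      rw [Finset.sum_comm]
      refine Finset.sum_congr rfl fun _ _ => Finset.sum_congr rfl fun _ _ => ?_
      ring
    rw [this, ← multinom]
    simp_rw [mul_pow, Finset.prod_mul_distrib, mul_assoc]

theorem core (n m : ℕ) (ν : ℂ) (hν : ν ≠ 0) (p q : Fin (n + 1) → ℂ)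
    (U : Matrix (Fin (n + 1)) (Fin (n + 1)) ℂ)
    (hmain : Matrix.diagonal (fun k => ν * p k) * (U * Matrix.diagonal q * U.transpose) = 1)
    (K : (Fin (n + 1) → ℕ) → (Fin (n + 1) → ℕ) → ℂ)
    (hK : ∀ η ∈ Omega n m, ∀ z : Fin (n + 1) → ℂ,
      ∑ ξ ∈ Omega n m, mc m ξ * K ξ η * ∏ l, z l ^ ξ l = ∏ k, (∑ l, U k l * z l) ^ η k)
    (hK' : ∀ ξ ∈ Omega n m, ∀ x : Fin (n + 1) → ℂ,
      ∑ η ∈ Omega n m, mc m η * K ξ η * ∏ l, x l ^ η l = ∏ k, (∑ l, U l k * x l) ^ ξ k)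
    (η : Fin (n + 1) → ℕ) (hη : η ∈ Omega n m) (ζ : Fin (n + 1) → ℕ) (hζ : ζ ∈ Omega n m) :
    ∑ ξ ∈ Omega n m, K ξ η * K ξ ζ * wpC m q ξ =
        (1 / ν) ^ m * (if η = ζ then 1 else 0) / wpC m p η := by
  have hkk : ∀ k k', ν * p k * (U * Matrix.diagonal q * U.transpose) k k' =
      if k = k' then 1 else 0 := by
    intro k k'
    have := congrFun (congrFun hmain k) k'
    rwa [Matrix.diagonal_mul, Matrix.one_apply] at this
  have hp : ∀ k, p k ≠ 0 := by
    intro k hk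
    have := hkk k k
    simp [hk] at this
  have hinner : ∀ (y : Fin (n + 1) → ℂ) k,
      ∑ l, U k l * (q l * ∑ k', U k' l * y k') = y k * (1 / (ν * p k)) := by
    intro y k
    have h0 : ν * p k ≠ 0 := mul_ne_zero hν (hp k)
    have e : ∑ l, U k l * (q l * ∑ k', U k' l * y k') =
        ∑ k', (U * Matrix.diagonal q * U.transpose) k k' * y k' := by
      simp_rw [Matrix.mul_apply (M := U * Matrix.diagonal q), Matrix.mul_diagonal,
        Matrix.transpose_apply, Finset.mul_sum, Finset.sum_mul]
      rw [Finset.sum_comm]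
      refine Finset.sum_congr rfl fun _ _ => Finset.sum_congr rfl fun _ _ => ?_
      ring
    rw [e]
    have : ∀ k', (U * Matrix.diagonal q * U.transpose) k k' =
        if k = k' then 1 / (ν * p k) else 0 := by
      intro k'
      apply mul_left_cancel₀ h0
      rw [hkk]
      split_ifs
      · rw [mul_one_div_cancel h0]
      · rw [mul_zero]
    simp_rw [this]
    simp [mul_comm]
  have key := coeff_unique n m
    (fun ζ => mc m ζ * ∑ ξ ∈ Omega n m, K ξ η * K ξ ζ * wpC m q ξ)
    (fun ζ => if η = ζ then ∏ k, (1 / (ν * p k)) ^ η k else 0) ?_ ζ hζ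
  · have hP : ∏ k, (1 / (ν * p k)) ^ η k = (1 / ν) ^ m / ∏ k, p k ^ η k := by
      rw [← mem_Omega_iff.1 hη, ← Finset.prod_pow_eq_pow_sum, ← Finset.prod_div_distrib]
      refine Finset.prod_congr rfl fun k _ => ?_
      rw [← div_pow, div_div]
    have hP0 : ∏ k, p k ^ η k ≠ 0 := Finset.prod_ne_zero_iff.2 fun k _ => pow_ne_zero _ (hp k)
    apply mul_left_cancel₀ (mc_ne m ζ)
    rw [key, hP]
    have hw : wpC m p η = mc m η * ∏ k, p k ^ η k := rfl
    rw [hw]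
    have := mc_ne m η
    split_ifs with h
    · subst h
      field_simp
    · simp
  · intro y
    have h1 := hK η hη (fun l => q l * ∑ k', U k' l * y k')
    simp_rw [hinner] at h1
    trans ∏ k, (y k * (1 / (ν * p k))) ^ η k
    · rw [← h1]
      simp_rw [mul_pow, Finset.prod_mul_distrib]
      symm
      rw [Finset.sum_congr rfl fun ξ hξ => by rw [← hK' ξ hξ y]]
      simp_rw [Finset.mul_sum, Finset.sum_mul]
      rw [Finset.sum_comm]
      refine Finset.sum_congr rfl fun ζ _ => Finset.sum_congr rfl fun ξ _ => ?_
      have hw : wpC m q ξ = mc m ξ * ∏ k, q k ^ ξ k := rfl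
      rw [hw]
      ring
    · simp only [ite_mul, zero_mul]
      rw [Finset.sum_ite_eq, if_pos hη]
      simp_rw [mul_pow, Finset.prod_mul_distrib]
      ring


/-- Orthogonality relations for the multivariate Krawtchouk polynomials `K(ξ,η)`
associated with a 4-tuple `(ν,P,P̂,U) ∈ K_n`, defined through Griffiths' generating
function. -/
theorem krawtchouk_orthogonality (n m : ℕ) (hn : 1 ≤ n) (hm : 0 < m)
    (ν : ℂ) (hν : ν ≠ 0) (p phat : Fin (n + 1) → ℂ)
    (U : Matrix (Fin (n + 1)) (Fin (n + 1)) ℂ)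
    (hp0 : p 0 = 1 / ν) (hphat0 : phat 0 = 1 / ν)
    (hU0 : ∀ k, U k 0 = 1 ∧ U 0 k = 1)
    (hmain : ν • (Matrix.diagonal p * U * Matrix.diagonal phat * U.transpose) = 1)
    (K : (Fin (n + 1) → ℕ) → (Fin (n + 1) → ℕ) → ℂ)
    (hK : ∀ η ∈ Omega n m, ∀ z : Fin (n + 1) → ℂ,
      ∑ ξ ∈ Omega n m,
          ((Nat.factorial m : ℂ) / ∏ i, (Nat.factorial (ξ i) : ℂ)) * K ξ η *
            ∏ l ∈ Finset.univ.erase (0 : Fin (n + 1)), z l ^ ξ l =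
        ∏ k : Fin (n + 1),
          (1 + ∑ l ∈ Finset.univ.erase (0 : Fin (n + 1)), U k l * z l) ^ η k) :
    ∀ η ∈ Omega n m, ∀ ζ ∈ Omega n m,
      (∑ ξ ∈ Omega n m, K ξ η * K ξ ζ * wpC m phat ξ =
        p 0 ^ m * (if η = ζ then 1 else 0) / wpC m p η) ∧
      (∑ ξ ∈ Omega n m, K η ξ * K ζ ξ * wpC m p ξ =
        p 0 ^ m * (if η = ζ then 1 else 0) / wpC m phat η) := by
  have hH : ∀ η ∈ Omega n m, ∀ z : Fin (n + 1) → ℂ,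
      ∑ ξ ∈ Omega n m, mc m ξ * K ξ η * ∏ l, z l ^ ξ l = ∏ k, (∑ l, U k l * z l) ^ η k :=
    fun η hη z => homog n m U (fun k => (hU0 k).1) K η hη (hK η hη) z
  have hD := duality n m U K hH
  have hdiag : ∀ r : Fin (n + 1) → ℂ,
      Matrix.diagonal (fun k => ν * r k) = ν • Matrix.diagonal r := by
    intro r
    rw [← Matrix.diagonal_smul]
    rfl
  have hA : Matrix.diagonal (fun k => ν * p k) * (U * Matrix.diagonal phat * U.transpose) = 1 := by
    rw [hdiag, Matrix.smul_mul, ← hmain]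
    simp only [Matrix.mul_assoc]
  have hB : Matrix.diagonal (fun k => ν * phat k) *
      (U.transpose * Matrix.diagonal p * U.transpose.transpose) = 1 := by
    have h1 : (ν • (Matrix.diagonal p * U)) * (Matrix.diagonal phat * U.transpose) = 1 := by
      rw [Matrix.smul_mul, ← hmain]
      simp only [Matrix.mul_assoc]
    have h2 := mul_eq_one_comm.1 h1
    rw [hdiag, Matrix.smul_mul, Matrix.transpose_transpose, ← h2, Matrix.mul_smul]
    simp only [Matrix.mul_assoc]
  intro η hη ζ hζ
  rw [hp0]
  exact ⟨core n m ν hν p phat U hA K hH hD η hη ζ hζ,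
    core n m ν hν phat p U.transpose hB (fun a b => K b a) hD hH η hη ζ hζ⟩
end

section
/- Let κ = (ν,P,P̂,U) ∈ K_n with U real and with p, p̂ probability vectors with all entries positive, and let K(ξ,η) be the multivariate Krawtchouk polynomials associated with κ and 2j. Then the linear map Λ defined on functions f: Ω_{2j} → ℝ by (Λf)(η) = p_0^{−j} Σ_{ξ∈Ω_{2j}} w_{p̂}(ξ) f(ξ) K(ξ,η) is a unitary operator from l²(w_{p̂}) to l²(w_p): for all f,g: Ω_{2j} → ℝ one has Σ_{η∈Ω_{2j}} (Λf)(η)(Λg)(η) w_p(η) = Σ_{ξ∈Ω_{2j}} f(ξ) g(ξ) w_{p̂}(ξ), and Λ is bijective. -/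
/-- The intertwiner `Λ : l²(w_{p̂}) → l²(w_p)`,
`(Λf)(η) = p_0^{−j} Σ_{ξ∈Ω_{2j}} w_{p̂}(ξ) f(ξ) K(ξ,η)` (here `j = m/2`). -/
noncomputable def LamOp (n m : ℕ) (p phat : Fin (n + 1) → ℝ)
    (K : (Fin (n + 1) → ℕ) → (Fin (n + 1) → ℕ) → ℝ)
    (f : {ξ // ξ ∈ Omega n m} → ℝ) (η : {ξ // ξ ∈ Omega n m}) : ℝ :=
  p 0 ^ (-(m : ℝ) / 2) * ∑ ξ : {ξ // ξ ∈ Omega n m}, wp m phat ξ.1 * f ξ * K ξ.1 η.1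

open Finset in
/-- Multinomial theorem over `Omega`. -/
lemma omega_multinomial (n m : ℕ) (x : Fin (n + 1) → ℝ) :
    ∑ ξ ∈ Omega n m, ((Nat.factorial m : ℝ) / ∏ i, (Nat.factorial (ξ i) : ℝ)) * ∏ i, x i ^ ξ i
      = (∑ i, x i) ^ m := by
  rw [Finset.sum_pow_eq_sum_piAntidiag]
  have hset : Omega n m = Finset.piAntidiag Finset.univ m := by
    ext ξ
    simp [Omega, Finset.Nat.mem_antidiagonalTuple]
  rw [hset]
  refine Finset.sum_congr rfl fun ξ hξ => ?_
  congr 1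
  have h1 : ∑ i, ξ i = m := (Finset.mem_piAntidiag.1 hξ).1
  have h2 := Nat.multinomial_spec (Finset.univ) ξ
  rw [h1] at h2
  have h3 : (∏ i, (Nat.factorial (ξ i) : ℝ)) ≠ 0 :=
    Finset.prod_ne_zero_iff.2 fun i _ => by exact_mod_cast Nat.factorial_ne_zero _
  rw [div_eq_iff h3, ← h2]
  push_cast
  ring

/-- Linear independence of the dehomogenized monomials. -/
lemma omega_coeff (n m : ℕ) (a : (Fin (n + 1) → ℕ) → ℝ)
    (h : ∀ z : Fin (n + 1) → ℝ,
      ∑ ξ ∈ Omega n m, a ξ * ∏ l ∈ Finset.univ.erase (0 : Fin (n + 1)), z l ^ ξ l = 0) :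
    ∀ ξ ∈ Omega n m, a ξ = 0 := by
  classical
  let e : (Fin (n + 1) → ℕ) → (Fin (n + 1) →₀ ℕ) := fun ξ =>
    Finsupp.equivFunOnFinite.symm (Function.update ξ 0 0)
  have he : ∀ ξ ∈ Omega n m, ∀ η ∈ Omega n m, e ξ = e η → ξ = η := by
    intro ξ hξ η hη hh
    have hh' := Finsupp.equivFunOnFinite.symm.injective hh
    have hs : ∀ i : Fin n, ξ i.succ = η i.succ := by
      intro i
      have := congrFun hh' i.succ
      simpa [Function.update_of_ne (Fin.succ_ne_zero i)] using this
    simp only [Omega, Finset.Nat.mem_antidiagonalTuple, Fin.sum_univ_succ] at hξ hη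
    simp only [hs] at hξ
    funext i
    refine Fin.cases ?_ hs i
    omega
  have hp : (∑ ξ ∈ Omega n m, MvPolynomial.monomial (e ξ) (a ξ)) = 0 := by
    apply MvPolynomial.funext
    intro z
    rw [map_sum, map_zero, ← h z]
    refine Finset.sum_congr rfl fun ξ _ => ?_
    rw [MvPolynomial.eval_monomial, Finsupp.prod_fintype _ _ (by simp)]
    congr 1
    rw [← Finset.mul_prod_erase _ _ (Finset.mem_univ (0 : Fin (n + 1)))]
    simp only [e, Finsupp.equivFunOnFinite_symm_apply_apply, Function.update_self, pow_zero, one_mul]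
    refine Finset.prod_congr rfl fun l hl => ?_
    rw [Function.update_of_ne (Finset.ne_of_mem_erase hl)]
  intro ξ hξ
  have hc := congrArg (MvPolynomial.coeff (e ξ)) hp
  rw [MvPolynomial.coeff_sum, Finset.sum_eq_single ξ] at hc
  · simpa using hc
  · intro η hη hne
    rw [MvPolynomial.coeff_monomial, if_neg]
    exact fun hh => hne (he η hη ξ hξ hh)
  · exact fun hh => absurd hξ hh

/-- Orthogonality relation for `U`. -/
lemma U_orth (n : ℕ) (ν : ℝ) (p phat : Fin (n + 1) → ℝ)
    (U : Matrix (Fin (n + 1)) (Fin (n + 1)) ℝ) (hν : ν ≠ 0)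
    (hmain : ν • (Matrix.diagonal p * U * Matrix.diagonal phat * U.transpose) = 1)
    (hphat : ∀ i, 0 < phat i) (z y : Fin (n + 1) → ℝ) :
    ∑ k, p k * (∑ l, U k l * z l) * (∑ l, U k l * y l) = ∑ l, 1 / ν * (z l * y l / phat l) := by
  have h1 : (Matrix.diagonal p * U) * (ν • (Matrix.diagonal phat * U.transpose)) = 1 := by
    rw [← hmain, Matrix.mul_smul, Matrix.mul_assoc, Matrix.mul_assoc, Matrix.mul_assoc]
  have h2 := mul_eq_one_comm.1 h1
  have h3 : ∀ l l', ∑ k, p k * U k l * U k l' = if l = l' then 1 / (ν * phat l) else 0 := by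
    intro l l'
    have := congrFun (congrFun h2 l) l'
    rw [Matrix.mul_apply] at this
    simp only [Matrix.smul_apply, Matrix.diagonal_mul, Matrix.transpose_apply, smul_eq_mul,
      Matrix.one_apply] at this
    have hne : ν * phat l ≠ 0 := mul_ne_zero hν (hphat l).ne'
    have h4 : ν * phat l * ∑ k, p k * U k l * U k l' = if l = l' then 1 else 0 := by
      rw [← this, Finset.mul_sum]
      exact Finset.sum_congr rfl fun k _ => by ring
    split_ifs with hl
    · rw [if_pos hl] at h4
      rw [eq_div_iff hne, mul_comm, h4]
    · rw [if_neg hl] at h4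
      exact (mul_eq_zero.1 h4).resolve_left hne
  calc _ = ∑ k, ∑ l, ∑ l', z l * y l' * (p k * U k l * U k l') := by
        refine Finset.sum_congr rfl fun k _ => ?_
        rw [mul_assoc, Finset.sum_mul_sum, Finset.mul_sum]
        refine Finset.sum_congr rfl fun l _ => ?_
        rw [Finset.mul_sum]
        exact Finset.sum_congr rfl fun l' _ => by ring
    _ = ∑ l, ∑ l', z l * y l' * ∑ k, (p k * U k l * U k l') := by
        rw [Finset.sum_comm]
        refine Finset.sum_congr rfl fun l _ => ?_
        rw [Finset.sum_comm]
        refine Finset.sum_congr rfl fun l' _ => ?_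
        rw [Finset.mul_sum]
    _ = _ := by
        refine Finset.sum_congr rfl fun l _ => ?_
        simp only [h3]
        rw [Finset.sum_eq_single l]
        · have := (hphat l).ne'
          simp
          field_simp
        · intro b _ hb
          simp [hb.symm]
        · simp

/-- Orthogonality of the Krawtchouk polynomials. -/
lemma K_orth (n m : ℕ)
    (ν : ℝ) (hν : ν ≠ 0) (p phat : Fin (n + 1) → ℝ)
    (U : Matrix (Fin (n + 1)) (Fin (n + 1)) ℝ)
    (hp0 : p 0 = 1 / ν) (hphat0 : phat 0 = 1 / ν)
    (hU0 : ∀ k, U k 0 = 1 ∧ U 0 k = 1)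
    (hmain : ν • (Matrix.diagonal p * U * Matrix.diagonal phat * U.transpose) = 1)
    (hphat : ∀ i, 0 < phat i)
    (K : (Fin (n + 1) → ℕ) → (Fin (n + 1) → ℕ) → ℝ)
    (hK : ∀ η ∈ Omega n m, ∀ z : Fin (n + 1) → ℝ,
      ∑ ξ ∈ Omega n m,
          ((Nat.factorial m : ℝ) / ∏ i, (Nat.factorial (ξ i) : ℝ)) * K ξ η *
            ∏ l ∈ Finset.univ.erase (0 : Fin (n + 1)), z l ^ ξ l =
        ∏ k : Fin (n + 1),
          (1 + ∑ l ∈ Finset.univ.erase (0 : Fin (n + 1)), U k l * z l) ^ η k) :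
    ∀ ξ ∈ Omega n m, ∀ ξ' ∈ Omega n m,
      wp m phat ξ * (∑ η ∈ Omega n m, wp m p η * K ξ η * K ξ' η) =
        if ξ = ξ' then p 0 ^ m else 0 := by
  classical
  set c : (Fin (n + 1) → ℕ) → ℝ :=
    fun ξ => (Nat.factorial m : ℝ) / ∏ i, (Nat.factorial (ξ i) : ℝ) with hc
  have hcpos : ∀ ξ, 0 < c ξ := fun ξ => div_pos (by exact_mod_cast Nat.factorial_pos _)
    (Finset.prod_pos fun i _ => by exact_mod_cast Nat.factorial_pos _)
  set M : (Fin (n + 1) → ℝ) → (Fin (n + 1) → ℕ) → ℝ :=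
    fun z ξ => ∏ l ∈ Finset.univ.erase (0 : Fin (n + 1)), z l ^ ξ l with hM
  set S : (Fin (n + 1) → ℕ) → (Fin (n + 1) → ℕ) → ℝ :=
    fun ξ ξ' => ∑ η ∈ Omega n m, wp m p η * K ξ η * K ξ' η with hS
  set Q : (Fin (n + 1) → ℕ) → ℝ := fun ξ => ∏ i, phat i ^ ξ i with hQ
  have hQpos : ∀ ξ, 0 < Q ξ := fun ξ => Finset.prod_pos fun i _ => pow_pos (hphat i) _
  have hlin : ∀ (z : Fin (n + 1) → ℝ) k,
      1 + ∑ l ∈ Finset.univ.erase (0 : Fin (n + 1)), U k l * z l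
        = ∑ l, U k l * Function.update z 0 1 l := by
    intro z k
    rw [← Finset.add_sum_erase _ _ (Finset.mem_univ (0 : Fin (n + 1))), (hU0 k).1,
      Function.update_self, one_mul]
    congr 1
    refine Finset.sum_congr rfl fun l hl => ?_
    rw [Function.update_of_ne (Finset.ne_of_mem_erase hl)]
  have hmon : ∀ (z : Fin (n + 1) → ℝ) ξ, ∏ l, Function.update z 0 1 l ^ ξ l = M z ξ := by
    intro z ξ
    rw [← Finset.mul_prod_erase _ _ (Finset.mem_univ (0 : Fin (n + 1))),
      Function.update_self, one_pow, one_mul]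
    refine Finset.prod_congr rfl fun l hl => ?_
    rw [Function.update_of_ne (Finset.ne_of_mem_erase hl)]
  have key : ∀ z y : Fin (n + 1) → ℝ,
      ∑ ξ ∈ Omega n m, ∑ ξ' ∈ Omega n m, c ξ * c ξ' * S ξ ξ' * M z ξ * M y ξ'
        = ∑ ξ ∈ Omega n m, c ξ * p 0 ^ m / Q ξ * M z ξ * M y ξ := by
    intro z y
    have e1 : ∑ ξ ∈ Omega n m, ∑ ξ' ∈ Omega n m, c ξ * c ξ' * S ξ ξ' * M z ξ * M y ξ'
        = ∑ η ∈ Omega n m, wp m p η * (∑ ξ ∈ Omega n m, c ξ * K ξ η * M z ξ) *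
            (∑ ξ ∈ Omega n m, c ξ * K ξ η * M y ξ) := by
      have : ∀ η ∈ Omega n m, wp m p η * (∑ ξ ∈ Omega n m, c ξ * K ξ η * M z ξ) *
            (∑ ξ ∈ Omega n m, c ξ * K ξ η * M y ξ) =
          ∑ ξ ∈ Omega n m, ∑ ξ' ∈ Omega n m,
            c ξ * c ξ' * (wp m p η * K ξ η * K ξ' η) * M z ξ * M y ξ' := by
        intro η _
        rw [mul_assoc, Finset.sum_mul_sum, Finset.mul_sum]
        refine Finset.sum_congr rfl fun l _ => ?_
        rw [Finset.mul_sum]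
        exact Finset.sum_congr rfl fun l' _ => by ring
      rw [Finset.sum_congr rfl this]
      symm
      rw [Finset.sum_comm]
      refine Finset.sum_congr rfl fun ξ _ => ?_
      rw [Finset.sum_comm]
      refine Finset.sum_congr rfl fun ξ' _ => ?_
      simp only [hS, Finset.mul_sum, Finset.sum_mul]
    rw [e1]
    have e2 : ∀ η ∈ Omega n m, wp m p η * (∑ ξ ∈ Omega n m, c ξ * K ξ η * M z ξ) *
            (∑ ξ ∈ Omega n m, c ξ * K ξ η * M y ξ) =
        c η * ∏ k, (p k * (∑ l, U k l * Function.update z 0 1 l) *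
          (∑ l, U k l * Function.update y 0 1 l)) ^ η k := by
      intro η hη
      rw [hK η hη z, hK η hη y]
      simp only [hlin, mul_pow, Finset.prod_mul_distrib, wp, hc]
      ring
    rw [Finset.sum_congr rfl e2, omega_multinomial, U_orth n ν p phat U hν hmain hphat,
      ← omega_multinomial]
    refine Finset.sum_congr rfl fun ξ hξ => ?_
    have hsum : ∑ i, ξ i = m := by
      simpa [Omega, Finset.Nat.mem_antidiagonalTuple] using hξ
    rw [← hp0, ← hmon z ξ, ← hmon y ξ]
    simp only [mul_pow, div_pow, Finset.prod_mul_distrib, Finset.prod_div_distrib,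
      Finset.prod_pow_eq_pow_sum, hsum]
    simp only [hc, hQ]
    ring
  have key2 : ∀ y : Fin (n + 1) → ℝ, ∀ ξ ∈ Omega n m,
      (∑ ξ' ∈ Omega n m, c ξ * c ξ' * S ξ ξ' * M y ξ') - c ξ * p 0 ^ m / Q ξ * M y ξ = 0 := by
    intro y
    apply omega_coeff n m (fun ξ => (∑ ξ' ∈ Omega n m, c ξ * c ξ' * S ξ ξ' * M y ξ')
      - c ξ * p 0 ^ m / Q ξ * M y ξ)
    intro z
    rw [← sub_eq_zero.2 (key z y), ← Finset.sum_sub_distrib]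
    refine Finset.sum_congr rfl fun ξ _ => ?_
    rw [sub_mul, Finset.sum_mul]
    congr 1
    · exact Finset.sum_congr rfl fun ξ' _ => by ring
    · ring
  intro ξ hξ ξ' hξ'
  have key3 := omega_coeff n m (fun ξ' => c ξ * c ξ' * S ξ ξ' -
    if ξ = ξ' then c ξ * p 0 ^ m / Q ξ else 0) (by
      intro y
      refine Eq.trans ?_ (key2 y ξ hξ)
      simp only [sub_mul, Finset.sum_sub_distrib, ite_mul, zero_mul, Finset.sum_ite_eq, hξ,
        if_true]
      try rfl) ξ' hξ'
  have hw : wp m phat ξ = c ξ * Q ξ := rfl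
  rw [hw]
  have h1 := (hcpos ξ).ne'
  have h2 := (hcpos ξ').ne'
  have h3 := (hQpos ξ).ne'
  change c ξ * Q ξ * S ξ ξ' = _
  split_ifs with hh
  · subst hh
    rw [if_pos rfl, sub_eq_zero] at key3
    field_simp at key3
    linarith
  · rw [if_neg hh, sub_zero] at key3
    have : S ξ ξ' = 0 := by simpa [h1, h2] using key3
    rw [this, mul_zero]

/-- `Λ` is a unitary operator from `l²(w_{p̂})` to `l²(w_p)`: it preserves inner
products and is bijective. -/
theorem LamOp_unitary (n m : ℕ) (hn : 1 ≤ n) (hm : 0 < m)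
    (ν : ℝ) (hν : ν ≠ 0) (p phat : Fin (n + 1) → ℝ)
    (U : Matrix (Fin (n + 1)) (Fin (n + 1)) ℝ)
    (hp0 : p 0 = 1 / ν) (hphat0 : phat 0 = 1 / ν)
    (hU0 : ∀ k, U k 0 = 1 ∧ U 0 k = 1)
    (hmain : ν • (Matrix.diagonal p * U * Matrix.diagonal phat * U.transpose) = 1)
    (hp : ∀ i, 0 < p i) (hp1 : ∑ i, p i = 1)
    (hphat : ∀ i, 0 < phat i) (hphat1 : ∑ i, phat i = 1)
    (K : (Fin (n + 1) → ℕ) → (Fin (n + 1) → ℕ) → ℝ)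
    (hK : ∀ η ∈ Omega n m, ∀ z : Fin (n + 1) → ℝ,
      ∑ ξ ∈ Omega n m,
          ((Nat.factorial m : ℝ) / ∏ i, (Nat.factorial (ξ i) : ℝ)) * K ξ η *
            ∏ l ∈ Finset.univ.erase (0 : Fin (n + 1)), z l ^ ξ l =
        ∏ k : Fin (n + 1),
          (1 + ∑ l ∈ Finset.univ.erase (0 : Fin (n + 1)), U k l * z l) ^ η k) :
    (∀ f g : {ξ // ξ ∈ Omega n m} → ℝ,
      ∑ η : {ξ // ξ ∈ Omega n m},
          LamOp n m p phat K f η * LamOp n m p phat K g η * wp m p η.1 =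
        ∑ ξ : {ξ // ξ ∈ Omega n m}, f ξ * g ξ * wp m phat ξ.1) ∧
    Function.Bijective (LamOp n m p phat K) := by
  classical
  have horth := K_orth n m ν hν p phat U hp0 hphat0 hU0 hmain hphat K hK
  have hsq : p 0 ^ (-(m : ℝ) / 2) * p 0 ^ (-(m : ℝ) / 2) * p 0 ^ m = 1 := by
    rw [← Real.rpow_add (hp 0), ← Real.rpow_natCast, ← Real.rpow_add (hp 0)]
    ring_nf
    exact Real.rpow_zero _
  have hinner : ∀ f g : {ξ // ξ ∈ Omega n m} → ℝ,
      ∑ η : {ξ // ξ ∈ Omega n m},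
          LamOp n m p phat K f η * LamOp n m p phat K g η * wp m p η.1 =
        ∑ ξ : {ξ // ξ ∈ Omega n m}, f ξ * g ξ * wp m phat ξ.1 := by
    intro f g
    set s := p 0 ^ (-(m : ℝ) / 2) with hs
    have e1 : ∀ η : {ξ // ξ ∈ Omega n m},
        LamOp n m p phat K f η * LamOp n m p phat K g η * wp m p η.1 =
        ∑ ξ : {ξ // ξ ∈ Omega n m}, ∑ ξ' : {ξ // ξ ∈ Omega n m},
          s * s * f ξ * (wp m phat ξ'.1 * g ξ') *
            (wp m phat ξ.1 * (wp m p η.1 * K ξ.1 η.1 * K ξ'.1 η.1)) := by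
      intro η
      simp only [LamOp, ← hs]
      rw [show ∀ A B w : ℝ, s * A * (s * B) * w = (s * s * w) * (A * B) by intros; ring,
        Finset.sum_mul_sum, Finset.mul_sum]
      refine Finset.sum_congr rfl fun ξ _ => ?_
      rw [Finset.mul_sum]
      exact Finset.sum_congr rfl fun ξ' _ => by ring
    rw [Finset.sum_congr rfl fun η _ => e1 η, Finset.sum_comm]
    refine Finset.sum_congr rfl fun ξ _ => ?_
    rw [Finset.sum_comm]
    have e2 : ∀ ξ' : {ξ // ξ ∈ Omega n m}, ∑ η : {ξ // ξ ∈ Omega n m},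
        s * s * f ξ * (wp m phat ξ'.1 * g ξ') *
            (wp m phat ξ.1 * (wp m p η.1 * K ξ.1 η.1 * K ξ'.1 η.1)) =
        if ξ = ξ' then s * s * f ξ * (wp m phat ξ'.1 * g ξ') * p 0 ^ m else 0 := by
      intro ξ'
      have h := horth ξ.1 ξ.2 ξ'.1 ξ'.2
      rw [← Finset.mul_sum, ← Finset.mul_sum,
        Finset.sum_coe_sort (Omega n m) (fun η => wp m p η * K ξ.1 η * K ξ'.1 η), h]
      simp only [Subtype.ext_iff]
      split_ifs <;> simp
    rw [Finset.sum_congr rfl fun ξ' _ => e2 ξ', Finset.sum_ite_eq, if_pos (Finset.mem_univ _)]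
    linear_combination (f ξ * g ξ * wp m phat ξ.1) * hsq
  refine ⟨hinner, ?_⟩
  have hwpos : ∀ ξ, 0 < wp m phat ξ := fun ξ => mul_pos
    (div_pos (by exact_mod_cast Nat.factorial_pos _)
      (Finset.prod_pos fun i _ => by exact_mod_cast Nat.factorial_pos _))
    (Finset.prod_pos fun i _ => pow_pos (hphat i) _)
  let L : ({ξ // ξ ∈ Omega n m} → ℝ) →ₗ[ℝ] ({ξ // ξ ∈ Omega n m} → ℝ) :=
    { toFun := LamOp n m p phat K
      map_add' := by
        intro f g
        funext η
        simp only [LamOp, Pi.add_apply, mul_add, add_mul, Finset.sum_add_distrib]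
      map_smul' := by
        intro a f
        funext η
        simp only [LamOp, Pi.smul_apply, smul_eq_mul, RingHom.id_apply, Finset.mul_sum]
        exact Finset.sum_congr rfl fun ξ _ => by ring }
  have hinj : Function.Injective L := by
    rw [← LinearMap.ker_eq_bot, LinearMap.ker_eq_bot']
    intro f hf
    have hf' : LamOp n m p phat K f = 0 := hf
    have h := hinner f f
    simp only [hf', Pi.zero_apply, zero_mul, Finset.sum_const_zero] at h
    have h2 := (Finset.sum_eq_zero_iff_of_nonneg
      (fun ξ _ => mul_nonneg (mul_self_nonneg (f ξ)) (hwpos ξ.1).le)).1 h.symm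
    funext ξ
    have h3 := h2 ξ (Finset.mem_univ _)
    simpa [(hwpos ξ.1).ne'] using h3
  exact ⟨hinj, LinearMap.injective_iff_surjective.1 hinj⟩
end

section
/- Let p̂ = (p̂_0,…,p̂_n) be a probability vector with all entries positive, and define operators on functions f: Ω_{2j} → ℝ by ρ(e_{kl})f(ξ) = √(p̂_k/p̂_l) ξ_l f(ξ − e_l + e_k) for k ≠ l, ρ(h_l)f(ξ) = (ξ_l − 2j/(n+1)) f(ξ), and ρ(h_l^⋆) = ρ(h_l) + Σ_{k=1}^n ρ(h_k). Then there exists a constant c ∈ ℝ such that for all f: Ω_{2j}×Ω_{2j} → ℝ and all (ξ,η) ∈ Ω_{2j}×Ω_{2j}, the single-edge multi-species SEP(2j) generator satisfies L_{x,y} f(ξ,η) = (1/2)[ 2 Σ_{0≤k<l≤n} ( (ρ(e_{lk})⊗ρ(e_{kl})) f + (ρ(e_{kl})⊗ρ(e_{lk})) f ) + Σ_{l=1}^n ( (ρ(h_l)⊗ρ(h_l^⋆)) f + (ρ(h_l^⋆)⊗ρ(h_l)) f ) ](ξ,η) − c f(ξ,η), where (A⊗B)f means A acting in the first variable and B in the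 second. In particular the right-hand side does not depend on p̂. -/
/-- Operators on the single-site function space. -/
abbrev Op (n : ℕ) := ((Fin (n + 1) → ℕ) → ℝ) → (Fin (n + 1) → ℕ) → ℝ

/-- `(A⊗B)f(ξ,η)`: `A` acts in the first variable, `B` in the second. -/
def tens {n : ℕ} (A B : Op n) (f : (Fin (n + 1) → ℕ) → (Fin (n + 1) → ℕ) → ℝ)
    (ξ η : Fin (n + 1) → ℕ) : ℝ :=
  A (fun ξ' => B (f ξ') η) ξ

/-- `ρ(e_{kl})f(ξ) = √(p̂_k/p̂_l) ξ_l f(ξ − e_l + e_k)`. -/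
noncomputable def rhoE {n : ℕ} (phat : Fin (n + 1) → ℝ) (k l : Fin (n + 1)) : Op n :=
  fun f ξ => Real.sqrt (phat k / phat l) * (ξ l : ℝ) * f (conf ξ k l)

/-- `ρ(h_l)f(ξ) = (ξ_l − 2j/(n+1)) f(ξ)` (here `m = 2j`). -/
noncomputable def rhoH (n m : ℕ) (l : Fin (n + 1)) : Op n :=
  fun f ξ => ((ξ l : ℝ) - (m : ℝ) / ((n : ℝ) + 1)) * f ξ

/-- `ρ(h_l^⋆) = ρ(h_l) + Σ_{k=1}^n ρ(h_k)`. -/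
noncomputable def rhoHstar (n m : ℕ) (l : Fin (n + 1)) : Op n :=
  fun f ξ => rhoH n m l f ξ + ∑ k ∈ Finset.univ.erase (0 : Fin (n + 1)), rhoH n m k f ξ

/-- The single-edge generator `L_{x,y}` of the multi-species SEP(2j), acting on
functions of two single-site configurations. -/
noncomputable def sepEdge2 (n : ℕ)
    (f : (Fin (n + 1) → ℕ) → (Fin (n + 1) → ℕ) → ℝ) (ξ η : Fin (n + 1) → ℕ) : ℝ :=
  ∑ k : Fin (n + 1), ∑ l : Fin (n + 1),
    if k < l then
      (ξ l * η k : ℝ) * (f (conf ξ k l) (conf η l k) - f ξ η) +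
        (η l * ξ k : ℝ) * (f (conf ξ l k) (conf η k l) - f ξ η)
    else 0

theorem aux_sum_lt {d : ℕ} (g : Fin d → Fin d → ℝ) :
    ∑ k, ∑ l, (if k < l then g k l + g l k else 0) = ∑ k, ∑ l, g k l - ∑ k, g k k := by
  have h1 : ∑ k, ∑ l, (if k < l then g k l + g l k else 0)
      = ∑ k, ∑ l, (if k < l then g k l else 0) + ∑ k, ∑ l, (if l < k then g k l else 0) := by
    rw [Finset.sum_comm (f := fun k l => if l < k then g k l else 0), ← Finset.sum_add_distrib]
    refine Finset.sum_congr rfl fun k _ => ?_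
    rw [← Finset.sum_add_distrib]
    refine Finset.sum_congr rfl fun l _ => ?_
    split_ifs <;> simp
  have h2 : ∑ k, g k k = ∑ k, ∑ l, (if k = l then g k l else 0) := by simp
  rw [h1, h2, ← Finset.sum_add_distrib, ← Finset.sum_sub_distrib]
  refine Finset.sum_congr rfl fun k _ => ?_
  rw [← Finset.sum_add_distrib, ← Finset.sum_sub_distrib]
  refine Finset.sum_congr rfl fun l _ => ?_
  rcases lt_trichotomy k l with h | h | h
  · simp [h, h.ne, h.not_gt]
  · simp [h]
  · simp [h, h.ne', h.not_gt]

/-- The single-edge SEP(2j) generator is `½ (ρ_{p̂}⊗ρ_{p̂})(Y) − c` for the Casimir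
element `Y`; in particular the right-hand side does not depend on `p̂`. -/
theorem sepEdge_eq_casimir_image (n m : ℕ) (hn : 1 ≤ n) (hm : 0 < m)
    (phat : Fin (n + 1) → ℝ) (hphat : ∀ i, 0 < phat i) (hphat1 : ∑ i, phat i = 1) :
    ∃ c : ℝ, ∀ f : (Fin (n + 1) → ℕ) → (Fin (n + 1) → ℕ) → ℝ,
      ∀ ξ ∈ Omega n m, ∀ η ∈ Omega n m,
        sepEdge2 n f ξ η =
          (1 / 2) *
            (2 * ∑ k : Fin (n + 1), ∑ l : Fin (n + 1),
                (if k < l then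
                  tens (rhoE phat l k) (rhoE phat k l) f ξ η +
                    tens (rhoE phat k l) (rhoE phat l k) f ξ η
                else 0) +
              ∑ l ∈ Finset.univ.erase (0 : Fin (n + 1)),
                (tens (rhoH n m l) (rhoHstar n m l) f ξ η +
                  tens (rhoHstar n m l) (rhoH n m l) f ξ η)) -
          c * f ξ η := by
  refine ⟨(m : ℝ) ^ 2 - (m : ℝ) ^ 2 / ((n : ℝ) + 1), fun f ξ hξ η hη => ?_⟩
  have hx : ∑ i, (ξ i : ℝ) = m := by
    have := Finset.Nat.mem_antidiagonalTuple.1 hξ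
    exact_mod_cast this
  have hy : ∑ i, (η i : ℝ) = m := by
    have := Finset.Nat.mem_antidiagonalTuple.1 hη
    exact_mod_cast this
  have hn0 : (n : ℝ) + 1 ≠ 0 := by positivity
  have hsq : ∀ k l, Real.sqrt (phat k / phat l) * Real.sqrt (phat l / phat k) = 1 := by
    intro k l
    have hk := hphat k
    have hl := hphat l
    rw [← Real.sqrt_mul (by positivity)]
    have : phat k / phat l * (phat l / phat k) = 1 := by field_simp
    rw [this, Real.sqrt_one]
  have hE : ∀ k l, tens (rhoE phat k l) (rhoE phat l k) f ξ η
      = (ξ l * η k : ℝ) * f (conf ξ k l) (conf η l k) := by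
    intro k l
    simp only [tens, rhoE]
    linear_combination ((ξ l * η k : ℝ) * f (conf ξ k l) (conf η l k)) * hsq k l
  have hL : sepEdge2 n f ξ η = ∑ k : Fin (n + 1), ∑ l : Fin (n + 1),
                (if k < l then
                  tens (rhoE phat l k) (rhoE phat k l) f ξ η +
                    tens (rhoE phat k l) (rhoE phat l k) f ξ η
                else 0) - (∑ k : Fin (n + 1), ∑ l : Fin (n + 1),
                (if k < l then (ξ l * η k : ℝ) + (ξ k * η l : ℝ) else 0)) * f ξ η := by
    rw [sepEdge2, Finset.sum_mul, ← Finset.sum_sub_distrib]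
    refine Finset.sum_congr rfl fun k _ => ?_
    rw [Finset.sum_mul, ← Finset.sum_sub_distrib]
    refine Finset.sum_congr rfl fun l _ => ?_
    rw [hE, hE]
    split_ifs <;> ring
  have hD : ∑ k : Fin (n + 1), ∑ l : Fin (n + 1),
      (if k < l then (ξ l * η k : ℝ) + (ξ k * η l : ℝ) else 0)
      = (m : ℝ) ^ 2 - ∑ k, (ξ k * η k : ℝ) := by
    rw [aux_sum_lt (fun k l => (ξ l * η k : ℝ))]
    simp only [← Finset.sum_mul, ← Finset.mul_sum, hx, hy]
    ring
  set s : ℝ := (m : ℝ) / ((n : ℝ) + 1) with hs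
  have hsm : ((n : ℝ) + 1) * s = m := by rw [hs]; field_simp
  have hA : ∑ k ∈ Finset.univ.erase (0 : Fin (n + 1)), ((ξ k : ℝ) - s) = -((ξ 0 : ℝ) - s) := by
    rw [Finset.sum_erase_eq_sub (Finset.mem_univ _), Finset.sum_sub_distrib, hx]
    simp [hsm]
  have hB : ∑ k ∈ Finset.univ.erase (0 : Fin (n + 1)), ((η k : ℝ) - s) = -((η 0 : ℝ) - s) := by
    rw [Finset.sum_erase_eq_sub (Finset.mem_univ _), Finset.sum_sub_distrib, hy]
    simp [hsm]
  have hAB : ∑ k ∈ Finset.univ.erase (0 : Fin (n + 1)), ((ξ k : ℝ) - s) * ((η k : ℝ) - s)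
      = ∑ k, (ξ k * η k : ℝ) - s * m - ((ξ 0 : ℝ) - s) * ((η 0 : ℝ) - s) := by
    rw [Finset.sum_erase_eq_sub (Finset.mem_univ _)]
    have : ∀ k, ((ξ k : ℝ) - s) * ((η k : ℝ) - s) = ξ k * η k - s * ξ k - s * η k + s * s := by
      intro k; ring
    simp only [this, Finset.sum_add_distrib, Finset.sum_sub_distrib, ← Finset.mul_sum, hx, hy]
    simp only [Finset.sum_const, Finset.card_univ, Fintype.card_fin, nsmul_eq_mul]
    push_cast
    linear_combination s * hsm
  have hC : ∑ l ∈ Finset.univ.erase (0 : Fin (n + 1)),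
                (tens (rhoH n m l) (rhoHstar n m l) f ξ η +
                  tens (rhoHstar n m l) (rhoH n m l) f ξ η)
      = 2 * (∑ k, (ξ k * η k : ℝ) - s * m) * f ξ η := by
    have h1 : ∀ l, tens (rhoH n m l) (rhoHstar n m l) f ξ η +
                  tens (rhoHstar n m l) (rhoH n m l) f ξ η
        = (2 * f ξ η) * (((ξ l : ℝ) - s) * ((η l : ℝ) - s))
          + (-((η 0 : ℝ) - s) * f ξ η) * ((ξ l : ℝ) - s)
          + (-((ξ 0 : ℝ) - s) * f ξ η) * ((η l : ℝ) - s) := by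
      intro l
      simp only [tens, rhoHstar, rhoH, ← hs, ← Finset.sum_mul, hA, hB]
      ring
    simp only [h1, Finset.sum_add_distrib, ← Finset.mul_sum, hA, hB, hAB]
    ring
  rw [hL, hD, hC]
  have hc : (m : ℝ) ^ 2 / ((n : ℝ) + 1) = s * m := by rw [hs]; ring
  rw [hc]
  ring
end

section
/- For λ > 0 and m, m' ∈ ℕ, the Charlier polynomials satisfy the orthogonality relation Σ_{z=0}^∞ C_m(z,λ) C_{m'}(z,λ) (λ^z/z!) e^{−λ} = δ_{m,m'} λ^{−m} m!, where the series converges absolutely. -/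
/-- The Charlier polynomial
`C_m(z,λ) = ₂F₀(−m,−z;;−1/λ) = Σ_{k=0}^m (−1)^k C(m,k) C(z,k) k! λ^{−k}`. -/
noncomputable def charlier (lam : ℝ) (m z : ℕ) : ℝ :=
  ∑ k ∈ Finset.range (m + 1),
    (-1 : ℝ) ^ k * (Nat.choose m k : ℝ) * (Nat.choose z k : ℝ) * (Nat.factorial k : ℝ) /
      lam ^ k

theorem charlier_zero_left (lam : ℝ) (z : ℕ) : charlier lam 0 z = 1 := by
  simp [charlier]

theorem charlier_zero_right (lam : ℝ) (m : ℕ) : charlier lam m 0 = 1 := by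
  simp [charlier, Finset.sum_range_succ']

theorem charlier_forward (lam : ℝ) (hlam : 0 < lam) (m z : ℕ) :
    charlier lam (m + 1) (z + 1) =
      charlier lam (m + 1) z - ((m : ℝ) + 1) / lam * charlier lam m z := by
  unfold charlier
  rw [Finset.sum_range_succ' _ (m + 1), Finset.sum_range_succ' _ (m + 1), Finset.mul_sum]
  simp only [Nat.choose_zero_right]
  rw [add_sub_right_comm, ← Finset.sum_sub_distrib]
  congr 1
  refine Finset.sum_congr rfl fun j _ => ?_
  have h : ((m : ℝ) + 1) * (m.choose j : ℝ) = ((m + 1).choose (j + 1) : ℝ) * ((j : ℝ) + 1) := by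
    exact_mod_cast Nat.add_one_mul_choose_eq m j
  rw [Nat.choose_succ_succ z j, Nat.factorial_succ]
  push_cast
  field_simp
  linear_combination lam ^ (j + 1) * (-1 : ℝ) ^ j * (z.choose j : ℝ) * (h)

theorem charlier_backward (lam : ℝ) (hlam : 0 < lam) (m z : ℕ) :
    charlier lam (m + 1) (z + 1) =
      charlier lam m (z + 1) - ((z : ℝ) + 1) / lam * charlier lam m z := by
  have e : charlier lam m (z + 1) = ∑ k ∈ Finset.range (m + 1 + 1),
    (-1 : ℝ) ^ k * (Nat.choose m k : ℝ) * (Nat.choose (z + 1) k : ℝ) * (Nat.factorial k : ℝ) /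
      lam ^ k := by
    rw [Finset.sum_range_succ _ (m + 1)]
    simp [charlier]
  rw [e]
  unfold charlier
  rw [Finset.sum_range_succ' _ (m + 1), Finset.sum_range_succ' _ (m + 1), Finset.mul_sum]
  simp only [Nat.choose_zero_right]
  rw [add_sub_right_comm, ← Finset.sum_sub_distrib]
  congr 1
  refine Finset.sum_congr rfl fun j _ => ?_
  have h : ((z : ℝ) + 1) * (z.choose j : ℝ) = ((z + 1).choose (j + 1) : ℝ) * ((j : ℝ) + 1) := by
    exact_mod_cast Nat.add_one_mul_choose_eq z j
  rw [Nat.choose_succ_succ m j, Nat.factorial_succ]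
  push_cast
  field_simp
  linear_combination lam ^ (j + 1) * (-1 : ℝ) ^ j * (m.choose j : ℝ) * (h)

theorem charlier_hasSum_congr {f g : ℕ → ℝ} {a : ℝ} (h : ∀ z, f z = g z) (hg : HasSum g a) :
    HasSum f a := by
  rw [funext h]
  exact hg

theorem charlier_step (lam : ℝ) (hlam : 0 < lam) (m : ℕ) (f : ℕ → ℝ) (a b : ℝ)
    (ha : HasSum (fun z : ℕ => charlier lam m z * f z *
      (lam ^ z / (Nat.factorial z : ℝ) * Real.exp (-lam))) a)
    (hb : HasSum (fun z : ℕ => charlier lam m z * f (z + 1) *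
      (lam ^ z / (Nat.factorial z : ℝ) * Real.exp (-lam))) b) :
    HasSum (fun z : ℕ => charlier lam (m + 1) z * f z *
      (lam ^ z / (Nat.factorial z : ℝ) * Real.exp (-lam))) (a - b) := by
  have hg : HasSum (fun z : ℕ => (charlier lam m z - charlier lam (m + 1) z) * f z *
      (lam ^ z / (Nat.factorial z : ℝ) * Real.exp (-lam))) b := by
    rw [← hasSum_nat_add_iff' 1]
    simp only [Finset.sum_range_one, charlier_zero_right, sub_self, zero_mul, sub_zero]
    refine charlier_hasSum_congr (fun z => ?_) hb
    rw [charlier_backward lam hlam, Nat.factorial_succ]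
    push_cast
    have : (Nat.factorial z : ℝ) ≠ 0 := by positivity
    field_simp
    ring
  refine charlier_hasSum_congr (fun z => ?_) (ha.sub hg)
  ring

theorem charlier_hasSum (lam : ℝ) (hlam : 0 < lam) (m n : ℕ) :
    HasSum (fun z : ℕ => charlier lam m z * charlier lam n z *
      (lam ^ z / (Nat.factorial z : ℝ) * Real.exp (-lam)))
      (if m = n then (Nat.factorial n : ℝ) / lam ^ n else 0) := by
  have h00 : HasSum (fun z : ℕ => charlier lam 0 z * charlier lam 0 z *
      (lam ^ z / (Nat.factorial z : ℝ) * Real.exp (-lam))) 1 := by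
    simp only [charlier_zero_left, one_mul]
    have h := (NormedSpace.expSeries_div_hasSum_exp lam).mul_right (Real.exp (-lam))
    rw [← Real.exp_eq_exp_ℝ, ← Real.exp_add, add_neg_cancel, Real.exp_zero] at h
    exact h
  have hstep0 : ∀ (m : ℕ) (a : ℝ), HasSum (fun z : ℕ => charlier lam m z * charlier lam 0 z *
      (lam ^ z / (Nat.factorial z : ℝ) * Real.exp (-lam))) a →
      HasSum (fun z : ℕ => charlier lam (m + 1) z * charlier lam 0 z *
      (lam ^ z / (Nat.factorial z : ℝ) * Real.exp (-lam))) 0 := by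
    intro m a h
    have := charlier_step lam hlam m (charlier lam 0) a a h
      (by simpa only [charlier_zero_left] using h)
    rwa [sub_self] at this
  have h0 : ∀ m : ℕ, HasSum (fun z : ℕ => charlier lam m z * charlier lam 0 z *
      (lam ^ z / (Nat.factorial z : ℝ) * Real.exp (-lam))) (if m = 0 then 1 else 0) := by
    intro m
    induction m with
    | zero => simpa using h00
    | succ m ih => simpa using hstep0 m _ ih
  induction m generalizing n with
  | zero =>
    have h := h0 n
    simp only [mul_comm (charlier lam n _)] at h
    convert h using 1
    by_cases hn : n = 0
    · simp [hn]
    · simp [hn, Ne.symm hn]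
  | succ m ih =>
    cases n with
    | zero => simpa using h0 (m + 1)
    | succ n =>
      have h1 := ih (n + 1)
      have h2 := h1.sub ((ih n).mul_left (((n : ℝ) + 1) / lam))
      have := charlier_step lam hlam m (charlier lam (n + 1)) _ _ h1 (by
        refine charlier_hasSum_congr (fun z => ?_) h2
        rw [charlier_forward lam hlam]
        ring)
      convert this using 1
      rw [sub_sub_cancel]
      by_cases hmn : m = n
      · simp only [hmn, if_true, Nat.factorial_succ]
        push_cast
        field_simp
        ring
      · simp [hmn]

/-- Orthogonality of the Charlier polynomials with respect to the Poisson weight: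
`Σ_z C_m(z,λ) C_{m'}(z,λ) (λ^z/z!) e^{−λ} = δ_{m,m'} λ^{−m} m!`, the series converging
absolutely. -/
theorem charlier_orthogonality (lam : ℝ) (hlam : 0 < lam) (m m' : ℕ) :
    Summable (fun z : ℕ =>
      |charlier lam m z * charlier lam m' z * (lam ^ z / (Nat.factorial z : ℝ) * Real.exp (-lam))|) ∧
    ∑' z : ℕ, charlier lam m z * charlier lam m' z *
        (lam ^ z / (Nat.factorial z : ℝ) * Real.exp (-lam)) =
      if m = m' then lam ^ (-(m' : ℤ)) * (Nat.factorial m' : ℝ) else 0 := by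
  have h := charlier_hasSum lam hlam m m'
  refine ⟨h.summable.abs, ?_⟩
  rw [h.tsum_eq, zpow_neg, zpow_natCast, div_eq_inv_mul]
end

section
/- For λ ≠ 0, m ∈ ℕ and z ∈ ℕ, the Charlier polynomials satisfy the raising and lowering relations: (i) m C_{m−1}(z,λ) = λ C_m(z,λ) − λ C_m(z+1,λ) (for m ≥ 1, and both sides vanish for m = 0), and (ii) λ C_{m+1}(z,λ) = λ C_m(z,λ) − z C_m(z−1,λ), where the term z C_m(z−1,λ) is interpreted as 0 when z = 0. -/
theorem charlier_eq_long (lam : ℝ) (m z N : ℕ) (h : m ≤ N) :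
    charlier lam m z = ∑ k ∈ Finset.range (N + 1),
      (-1 : ℝ) ^ k * (Nat.choose m k : ℝ) * (Nat.choose z k : ℝ) * (Nat.factorial k : ℝ) /
        lam ^ k := by
  unfold charlier
  apply Finset.sum_subset
  · intro k hk
    simp only [Finset.mem_range] at *
    omega
  · intro k _ hk
    simp only [Finset.mem_range] at hk
    rw [Nat.choose_eq_zero_of_lt (show m < k by omega)]
    simp

theorem charlier_symm (lam : ℝ) (m z : ℕ) : charlier lam m z = charlier lam z m := by
  rw [charlier_eq_long lam m z (m + z) (by omega), charlier_eq_long lam z m (m + z) (by omega)]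
  apply Finset.sum_congr rfl
  intro k _
  ring

theorem charlier_first (lam : ℝ) (hlam : lam ≠ 0) (m z : ℕ) :
    (m : ℝ) * charlier lam (m - 1) z
      = lam * charlier lam m z - lam * charlier lam m (z + 1) := by
  rcases m with _ | n
  · simp [charlier]
  · rw [Nat.add_sub_cancel]
    unfold charlier
    rw [Finset.sum_range_succ' _ (n + 1), Finset.sum_range_succ' _ (n + 1), ← mul_sub]
    simp only [Nat.choose_zero_right, add_sub_add_right_eq_sub]
    rw [← Finset.sum_sub_distrib, Finset.mul_sum, Finset.mul_sum]
    apply Finset.sum_congr rfl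
    intro k _
    have h1 : ((n : ℝ) + 1) * (n.choose k : ℝ) = ((n + 1).choose (k + 1) : ℝ) * ((k : ℝ) + 1) := by
      exact_mod_cast Nat.add_one_mul_choose_eq n k
    rw [Nat.choose_succ_succ z k, Nat.factorial_succ]
    push_cast
    field_simp
    linear_combination ((-1 : ℝ) ^ k * (z.choose k : ℝ) * lam ^ (k + 1)) * h1

/-- Raising and lowering relations for Charlier polynomials:
`m C_{m−1}(z,λ) = λ C_m(z,λ) − λ C_m(z+1,λ)` (both sides vanish for `m = 0`, truncated
subtraction on ℕ) and `λ C_{m+1}(z,λ) = λ C_m(z,λ) − z C_m(z−1,λ)` (the last term being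
`0` when `z = 0`). -/
theorem charlier_raising_lowering (lam : ℝ) (hlam : lam ≠ 0) (m z : ℕ) :
    ((m : ℝ) * charlier lam (m - 1) z = lam * charlier lam m z - lam * charlier lam m (z + 1)) ∧
    (lam * charlier lam (m + 1) z = lam * charlier lam m z - (z : ℝ) * charlier lam m (z - 1)) := by
  refine ⟨charlier_first lam hlam m z, ?_⟩
  have h := charlier_first lam hlam z m
  rw [charlier_symm lam (m + 1) z, charlier_symm lam m z, charlier_symm lam m (z - 1)]
  linarith
end

section
/- Let n ≥ 1, λ > 0, and define C(ξ,η,λ) = Π_{i=1}^n e^λ C_{ξ_i}(η_i,λ) for ξ,η ∈ ℕ^n. Then for every 1 ≤ i ≤ n and all ξ,η ∈ ℕ^n: (i) ξ_i C(ξ − e_i, η, λ) = λ C(ξ,η,λ) − λ C(ξ, η + e_i, λ) (the left side interpreted as 0 when ξ_i = 0), and (ii) λ C(ξ + e_i, η, λ) = λ C(ξ,η,λ) − η_i C(ξ, η − e_i, λ) (the last term interpreted as 0 when η_i = 0). Equivalently, with ρ_λ(Q_i)f(ξ) = ξ_i f(ξ−e_i), ρ_λ(P_i)f(ξ) = λ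 f(ξ+e_i), and θ(P_i) = Z − P_i, θ(Q_i) = Z − Q_i, ρ_λ(Z)f = λf, one has ρ_λ(X*)C(·,η,λ)(ξ) = ρ_λ(θ(X))C(ξ,·,λ)(η) for X ∈ {P_i, Q_i}. -/
/-- `C(ξ,η,λ) = ∏_{i=1}^n e^λ C_{ξ_i}(η_i,λ)`. -/
noncomputable def charlierProd (n : ℕ) (lam : ℝ) (ξ η : Fin n → ℕ) : ℝ :=
  ∏ i, Real.exp lam * charlier lam (ξ i) (η i)

/-- `ξ + e_i`. -/
def addE {n : ℕ} (ξ : Fin n → ℕ) (i : Fin n) : Fin n → ℕ :=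
  fun r => if r = i then ξ r + 1 else ξ r

/-- `ξ − e_i` (truncated subtraction on ℕ). -/
def subE {n : ℕ} (ξ : Fin n → ℕ) (i : Fin n) : Fin n → ℕ :=
  fun r => ξ r - if r = i then 1 else 0

theorem charlier_ext (lam : ℝ) (m z N : ℕ) (h : m + 1 ≤ N) :
    charlier lam m z = ∑ k ∈ Finset.range N,
      (-1 : ℝ) ^ k * (Nat.choose m k : ℝ) * (Nat.choose z k : ℝ) * (Nat.factorial k : ℝ) /
        lam ^ k := by
  unfold charlier
  apply Finset.sum_subset
  · intro k hk
    simp only [Finset.mem_range] at *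
    omega
  · intro k _ hk
    simp only [Finset.mem_range] at hk
    rw [Nat.choose_eq_zero_of_lt (by omega : m < k)]
    simp

theorem charlier_step_s14 (lam : ℝ) (hlam : 0 < lam) (m z : ℕ) :
    (m : ℝ) * charlier lam (m - 1) z = lam * charlier lam m z - lam * charlier lam m (z + 1) := by
  cases m with
  | zero => simp [charlier]
  | succ m =>
    unfold charlier
    rw [Finset.sum_range_succ' _ (m + 1), Finset.sum_range_succ' _ (m + 1)]
    simp only [Nat.add_sub_cancel, Nat.choose_zero_right]
    rw [← mul_sub, add_sub_add_right_eq_sub, ← Finset.sum_sub_distrib, Finset.mul_sum,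
      Finset.mul_sum]
    apply Finset.sum_congr rfl
    intro k _
    have h : ((m : ℝ) + 1) * (m.choose k : ℝ) = ((m + 1).choose (k + 1) : ℝ) * (k + 1) := by
      exact_mod_cast Nat.add_one_mul_choose_eq m k
    rw [Nat.choose_succ_succ z k, Nat.factorial_succ]
    push_cast
    have hl : lam ≠ 0 := hlam.ne'
    field_simp
    linear_combination lam * lam ^ k * (-1 : ℝ) ^ k * (z.choose k : ℝ) * h

theorem charlierProd_split (n : ℕ) (lam : ℝ) (i : Fin n) (ξ η ξ' η' : Fin n → ℕ)
    (h : ∀ r, r ≠ i → ξ' r = ξ r ∧ η' r = η r) :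
    charlierProd n lam ξ' η' = charlier lam (ξ' i) (η' i) * (Real.exp lam *
      ∏ r ∈ Finset.univ.erase i, Real.exp lam * charlier lam (ξ r) (η r)) := by
  unfold charlierProd
  rw [← Finset.mul_prod_erase _ _ (Finset.mem_univ i)]
  rw [Finset.prod_congr rfl (fun r hr => by
    rw [(h r (Finset.ne_of_mem_erase hr)).1, (h r (Finset.ne_of_mem_erase hr)).2])]
  ring

/-- The intertwining relations `ρ_λ(X*)C(·,η,λ)(ξ) = ρ_λ(θ(X))C(ξ,·,λ)(η)` for
`X ∈ {P_i, Q_i}` in the Heisenberg Lie algebra `h_n`: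
`ξ_i C(ξ−e_i,η,λ) = λ C(ξ,η,λ) − λ C(ξ,η+e_i,λ)` and
`λ C(ξ+e_i,η,λ) = λ C(ξ,η,λ) − η_i C(ξ,η−e_i,λ)`. -/
theorem charlierProd_intertwining (n : ℕ) (hn : 1 ≤ n) (lam : ℝ) (hlam : 0 < lam)
    (i : Fin n) (ξ η : Fin n → ℕ) :
    ((ξ i : ℝ) * charlierProd n lam (subE ξ i) η =
      lam * charlierProd n lam ξ η - lam * charlierProd n lam ξ (addE η i)) ∧
    (lam * charlierProd n lam (addE ξ i) η =
      lam * charlierProd n lam ξ η - (η i : ℝ) * charlierProd n lam ξ (subE η i)) := by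
  have h1 := charlier_step_s14 lam hlam (ξ i) (η i)
  have h2 := charlier_step_s14 lam hlam (η i) (ξ i)
  rw [charlier_symm lam _ (ξ i), charlier_symm lam _ (ξ i), charlier_symm lam _ (ξ i + 1)] at h2
  rw [charlierProd_split n lam i ξ η (subE ξ i) η (fun r hr => by simp [subE, hr]),
    charlierProd_split n lam i ξ η ξ η (fun r hr => by simp),
    charlierProd_split n lam i ξ η ξ (addE η i) (fun r hr => by simp [addE, hr]),
    charlierProd_split n lam i ξ η (addE ξ i) η (fun r hr => by simp [addE, hr]),
    charlierProd_split n lam i ξ η ξ (subE η i) (fun r hr => by simp [subE, hr])]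
  simp only [subE, addE, if_true]
  generalize Real.exp lam * _ = E
  constructor
  · linear_combination E * h1
  · linear_combination E * h2
end
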